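/- arXiv:2306.17438 — 4 statements merged into one kernel-verified Lean document; each statement's English description precedes it below -/
import Mathlib

section
/- Let G be an abelian group, f, g : G → ℂ functions, and k, n ∈ ℕ. If (Δ_{y₁,…,y_{k+1}} f)(x) = 0 for all x, y₁,…,y_{k+1} ∈ G and (Δ_{y₁,…,y_{n+1}} g)(x) = 0 for all x, y₁,…,y_{n+1} ∈ G, then the pointwise product f·g satisfies (Δ_{y₁,…,y_{k+n+1}} (f·g))(x) = 0 for all x, y₁,…,y_{k+n+1} ∈ G. -/
variable {G : Type*} [AddCommGroup G]

/-- The plain difference operator: `(Δ_y f)(x) = f(x+y) − f(x)`. -/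
def plainDiff (y : G) (f : G → ℂ) : G → ℂ :=
  fun x => f (x + y) - f x

/-- Iterated plain difference: `Δ_{y₁,…,yₙ} f = Δ_{y₁}(⋯(Δ_{yₙ} f))`. -/
def plainDiffIter (ys : List G) (f : G → ℂ) : G → ℂ :=
  ys.foldr plainDiff f

theorem plainDiffIter_add (ys : List G) (f g : G → ℂ) :
    plainDiffIter ys (f + g) = plainDiffIter ys f + plainDiffIter ys g := by
  induction ys with
  | nil => rfl
  | cons y ys ih =>
    change plainDiff y (plainDiffIter ys (f + g)) = _
    rw [ih]
    funext x
    exact add_sub_add_comm _ _ _ _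

theorem plainDiffIter_zero (ys : List G) : plainDiffIter ys 0 = 0 := by
  simpa using plainDiffIter_add ys 0 0

theorem plainDiffIter_append_singleton (ys : List G) (y : G) (f : G → ℂ) :
    plainDiffIter (ys ++ [y]) f = plainDiffIter ys (plainDiff y f) := by
  simp [plainDiffIter]

theorem plainDiff_mul (y : G) (f g : G → ℂ) :
    plainDiff y (f * g) =
      plainDiff y f * g + f * plainDiff y g + plainDiff y f * plainDiff y g := by
  funext x
  simp only [plainDiff, Pi.mul_apply, Pi.add_apply]
  ring

/-- All `a`-fold differences of `f` vanish identically. -/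
def DiffsVanish (a : ℕ) (f : G → ℂ) : Prop :=
  ∀ ys : List G, ys.length = a → plainDiffIter ys f = 0

theorem DiffsVanish.eq_zero {f : G → ℂ} (hf : DiffsVanish 0 f) : f = 0 :=
  hf [] rfl

theorem DiffsVanish.plainDiff {a : ℕ} {f : G → ℂ} (hf : DiffsVanish (a + 1) f) (y : G) :
    DiffsVanish a (plainDiff y f) := fun ys hys => by
  rw [← plainDiffIter_append_singleton]
  exact hf _ (by simp [hys])

theorem diffsVanish_of_ofFn {a : ℕ} {f : G → ℂ}
    (hf : ∀ (x : G) (y : Fin a → G), plainDiffIter (List.ofFn y) f x = 0) :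
    DiffsVanish a f := by
  rintro ys rfl
  funext x
  simpa using hf x ys.get

theorem DiffsVanish.mul {s a b : ℕ} {f g : G → ℂ} (hf : DiffsVanish a f)
    (hg : DiffsVanish b g) (hab : a + b ≤ s + 1) : DiffsVanish s (f * g) := by
  induction s generalizing a b f g with
  | zero =>
    intro ys _
    obtain rfl | rfl : a = 0 ∨ b = 0 := by omega
    · rw [hf.eq_zero, zero_mul, plainDiffIter_zero]
    · rw [hg.eq_zero, mul_zero, plainDiffIter_zero]
  | succ s ih =>
    intro ys hys
    obtain _ | a := a
    · rw [hf.eq_zero, zero_mul, plainDiffIter_zero]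
    obtain _ | b := b
    · rw [hg.eq_zero, mul_zero, plainDiffIter_zero]
    obtain rfl | ⟨ys, y, rfl⟩ := ys.eq_nil_or_concat'
    · simp at hys
    have hlen : ys.length = s := by simpa using hys
    rw [plainDiffIter_append_singleton, plainDiff_mul, plainDiffIter_add, plainDiffIter_add,
      ih (hf.plainDiff y) hg (by omega) ys hlen, ih hf (hg.plainDiff y) (by omega) ys hlen,
      ih (hf.plainDiff y) (hg.plainDiff y) (by omega) ys hlen, add_zero, add_zero]

/-- if all `(k+1)`-fold differences of `f` and all `(n+1)`-fold
differences of `g` vanish identically, then all `(k+n+1)`-fold differences of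
the pointwise product `f·g` vanish identically. -/
theorem plainDiffIter_mul_eq_zero (f g : G → ℂ) (k n : ℕ)
    (hf : ∀ (x : G) (y : Fin (k + 1) → G), plainDiffIter (List.ofFn y) f x = 0)
    (hg : ∀ (x : G) (y : Fin (n + 1) → G), plainDiffIter (List.ofFn y) g x = 0) :
    ∀ (x : G) (y : Fin (k + n + 1) → G),
      plainDiffIter (List.ofFn y) (fun z => f z * g z) x = 0 := by
  intro x y
  exact congrFun ((diffsVanish_of_ofFn hf).mul (diffsVanish_of_ofFn hg) (by omega) _
    List.length_ofFn) x
end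

section
/- Let G be an abelian group, m : G → ℂ a function satisfying m(x+y) = m(x)·m(y) and m(x) ≠ 0 for all x, y ∈ G, f : G → ℂ a function, and n ∈ ℕ. Then (Δ_{m;y₁,…,y_{n+1}} f)(x) = 0 for all x, y₁,…,y_{n+1} ∈ G if and only if the function p : G → ℂ defined by p(x) = f(x)·m(x)⁻¹ satisfies (Δ_{y₁,…,y_{n+1}} p)(x) = 0 for all x, y₁,…,y_{n+1} ∈ G. -/
variable {G : Type*} [AddCommGroup G]

/-- The `m`-modified difference operator: `(Δ_{m;y} f)(x) = f(x+y) − m(y)·f(x)`. -/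
def mDiff (m : G → ℂ) (y : G) (f : G → ℂ) : G → ℂ :=
  fun x => f (x + y) - m y * f x

/-- Iterated `m`-modified difference: `Δ_{m;y₁,…,yₙ} f = Δ_{m;y₁}(⋯(Δ_{m;yₙ} f))`. -/
def mDiffIter (m : G → ℂ) (ys : List G) (f : G → ℂ) : G → ℂ :=
  ys.foldr (mDiff m) f

/-- Dividing by `m` turns iterated `m`-modified differences into plain ones, up to a factor. -/
theorem plainDiffIter_mul_inv (m : G → ℂ)
    (hm : ∀ x y, m (x + y) = m x * m y) (hm0 : ∀ x, m x ≠ 0) (f : G → ℂ) (ys : List G) (x : G) :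
    plainDiffIter ys (fun z => f z * (m z)⁻¹) x =
      mDiffIter m ys f x * (m x * (ys.map m).prod)⁻¹ := by
  induction ys generalizing x with
  | nil => simp [plainDiffIter, mDiffIter]
  | cons y ys ih =>
    change plainDiffIter ys _ (x + y) - plainDiffIter ys _ x =
      (mDiffIter m ys f (x + y) - m y * mDiffIter m ys f x) * _
    have hP : (ys.map m).prod ≠ 0 := by
      simpa [List.prod_eq_zero_iff] using fun z _ => hm0 z
    have hx := hm0 x
    have hy := hm0 y
    rw [ih, ih, hm, List.map_cons, List.prod_cons]
    field_simp

/-- for a nonvanishing multiplicative `m`, the `(n+1)`-fold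
`m`-modified differences of `f` vanish identically iff the `(n+1)`-fold plain
differences of `p = f·m⁻¹` vanish identically. -/
theorem mDiffIter_eq_zero_iff (m : G → ℂ)
    (hm : ∀ x y, m (x + y) = m x * m y) (hm0 : ∀ x, m x ≠ 0)
    (f : G → ℂ) (n : ℕ) :
    (∀ (x : G) (y : Fin (n + 1) → G), mDiffIter m (List.ofFn y) f x = 0) ↔
      (∀ (x : G) (y : Fin (n + 1) → G),
        plainDiffIter (List.ofFn y) (fun z => f z * (m z)⁻¹) x = 0) := by
  have hmul : ∀ (ys : List G) (x : G), m x * (ys.map m).prod ≠ 0 := fun ys x =>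
    mul_ne_zero (hm0 x) (by simpa [List.prod_eq_zero_iff] using fun z _ => hm0 z)
  refine forall_congr' fun x => forall_congr' fun y => ?_
  rw [plainDiffIter_mul_inv m hm hm0, mul_eq_zero_iff_right (inv_ne_zero (hmul _ x))]
end

section
/- (Schwartz) Let V be a ℂ-linear subspace of the space C(ℝ,ℂ) of continuous complex-valued functions on ℝ that is invariant under all translations f ↦ f(·+g) and closed in the topology of uniform convergence on compact sets (the compact-open topology). Then the set of functions of the form x ↦ x^k·exp(λx), with k ∈ ℕ and λ ∈ ℂ, that belong to V spans a ℂ-linear subspace that is dense in V. -/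
section
open Metric Set MeasureTheory Real Filter Topology

theorem setIntegral_ball_eq_integral_circleAverage {v : ℂ → ℝ} (hv : Continuous v) (c : ℂ)
    {r : ℝ} (hr : 0 ≤ r) :
    ∫ z in ball c r, v z = ∫ ρ in 0..r, 2 * π * ρ * circleAverage v c ρ := by
  have h1 : ∫ z in ball c r, v z = ∫ z, (ball 0 r).indicator (fun z ↦ v (z + c)) z := by
    rw [← integral_indicator measurableSet_ball, ← integral_add_right_eq_self _ c]
    congr 1 with z
    by_cases h : ‖z‖ < r <;> simp [indicator, h]
  have hg : Continuous fun p : ℝ × ℝ ↦ p.1 * v (circleMap c p.1 p.2) := by fun_prop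
  have h2 : ∫ z, (ball 0 r).indicator (fun z ↦ v (z + c)) z =
      ∫ p in Ioo 0 r ×ˢ Ioo (-π) π, p.1 * v (circleMap c p.1 p.2) := by
    rw [← Complex.integral_comp_polarCoord_symm, ← integral_indicator
      (measurableSet_Ioo.prod measurableSet_Ioo), ← integral_indicator
      polarCoord.open_target.measurableSet]
    congr 1 with p
    simp only [indicator, polarCoord_target, mem_prod, mem_Ioi, mem_Ioo, mem_ball_zero_iff,
      smul_eq_mul, circleMap, Complex.polarCoord_symm_apply]
    rcases le_or_gt p.1 0 with hp | hp
    · rw [if_neg (by grind), if_neg (by grind)]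
    · by_cases h : p.1 < r <;> by_cases h' : -π < p.2 ∧ p.2 < π <;>
        simp [hp, h, h', abs_of_pos hp, Complex.exp_mul_I, add_comm]
  rw [h1, h2, Measure.volume_eq_prod, setIntegral_prod]
  · rw [intervalIntegral.integral_of_le hr, integral_Ioc_eq_integral_Ioo]
    refine setIntegral_congr_fun measurableSet_Ioo fun ρ _ ↦ ?_
    have hper : Function.Periodic (fun θ ↦ v (circleMap c ρ θ)) (2 * π) := fun θ ↦ by
      simp [periodic_circleMap c ρ θ]
    have := hper.intervalIntegral_add_eq (-π) 0
    rw [zero_add, show -π + 2 * π = π by ring,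
      intervalIntegral.integral_of_le (by linarith [pi_pos]), integral_Ioc_eq_integral_Ioo] at this
    simp only [integral_const_mul, circleAverage_def, smul_eq_mul]
    rw [this]
    field_simp
  · exact (hg.continuousOn.integrableOn_compact (isCompact_Icc.prod isCompact_Icc)).mono_set
      (prod_mono Ioo_subset_Icc_self Ioo_subset_Icc_self)

theorem log_norm_le_circleAverage {f : ℂ → ℂ} (hf : Differentiable ℂ f) {c : ℂ} {R : ℝ}
    (hR : 0 < R) (hfc : f c ≠ 0) :
    log ‖f c‖ ≤ circleAverage (fun z ↦ log ‖f z‖) c R := by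
  have ha : AnalyticOnNhd ℂ f (closedBall c |R|) := fun z _ ↦ hf.analyticAt z
  rw [ha.circleAverage_log_norm hR.ne' hfc]
  refine le_add_of_nonneg_left (finsum_nonneg fun u ↦ ?_)
  by_cases hu : u ∈ closedBall c |R|
  · refine mul_nonneg ?_ ?_
    · exact_mod_cast MeromorphicOn.AnalyticOnNhd.divisor_nonneg ha u
    · rcases eq_or_ne u c with rfl | h
      · simp
      · have : 0 < ‖c - u‖ := norm_pos_iff.2 (sub_ne_zero.2 h.symm)
        apply log_nonneg
        rw [← div_eq_mul_inv, one_le_div this, ← dist_eq_norm, dist_comm]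
        simpa [abs_of_pos hR] using hu
  · simp [Function.locallyFinsuppWithin.apply_eq_zero_of_notMem _ hu]

theorem posLog_norm_le_circleAverage {f : ℂ → ℂ} (hf : Differentiable ℂ f) (c : ℂ) {R : ℝ}
    (hR : 0 < R) :
    log⁺ ‖f c‖ ≤ circleAverage (fun z ↦ log⁺ ‖f z‖) c R := by
  have hm : MeromorphicOn f (sphere c |R|) := fun z _ ↦ (hf.analyticAt z).meromorphicAt
  by_cases h : log ‖f c‖ ≤ 0
  · rw [posLog_apply, max_eq_left h]
    exact circleAverage_nonneg_of_nonneg fun _ _ ↦ posLog_nonneg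
  · rw [posLog_apply, max_eq_right (not_le.1 h).le]
    refine (log_norm_le_circleAverage hf hR ?_).trans ?_
    · rintro h0
      simp [h0] at h
    · exact circleAverage_mono hm.circleIntegrable_log_norm hm.circleIntegrable_posLog_norm
        fun z _ ↦ (le_max_right _ _)

theorem posLog_norm_le_of_circleAverage_le {f : ℂ → ℂ} (hf : Differentiable ℂ f) {c w : ℂ}
    {s B : ℝ} (hs : 0 < s) (hws : ‖w - c‖ ≤ s)
    (hB : ∀ ρ, 0 < ρ → ρ ≤ 2 * s → circleAverage (fun z ↦ log⁺ ‖f z‖) c ρ ≤ B) :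
    log⁺ ‖f w‖ ≤ 4 * B := by
  have hv : Continuous fun z ↦ log⁺ ‖f z‖ := continuous_posLog.comp hf.continuous.norm
  have hlin (r K : ℝ) : ∫ ρ in 0..r, 2 * π * ρ * K = π * r ^ 2 * K := by
    simp only [mul_assoc, intervalIntegral.integral_const_mul, intervalIntegral.integral_mul_const,
      integral_id]
    ring
  have hint (c : ℂ) (r : ℝ) :
      IntervalIntegrable (fun ρ ↦ 2 * π * ρ * circleAverage (fun z ↦ log⁺ ‖f z‖) c ρ) volume 0 r :=
    Continuous.intervalIntegrable (by fun_prop) _ _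
  have h1 : π * s ^ 2 * log⁺ ‖f w‖ ≤ ∫ z in ball w s, log⁺ ‖f z‖ := by
    rw [setIntegral_ball_eq_integral_circleAverage hv w hs.le, ← hlin]
    refine intervalIntegral.integral_mono_on_of_le_Ioo hs.le
      (Continuous.intervalIntegrable (by fun_prop) _ _) (hint w s) fun ρ hρ ↦ ?_
    have := posLog_norm_le_circleAverage hf w hρ.1
    have := hρ.1
    gcongr
  have h2 : ∫ z in ball w s, log⁺ ‖f z‖ ≤ ∫ z in ball c (2 * s), log⁺ ‖f z‖ := by
    refine setIntegral_mono_set ?_ (Eventually.of_forall fun _ ↦ posLog_nonneg)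
      (LE.le.eventuallyLE (ball_subset_ball' ?_))
    · exact (hv.continuousOn.integrableOn_compact (isCompact_closedBall c (2 * s))).mono_set
        ball_subset_closedBall
    · rw [dist_eq_norm]; linarith
  have h3 : ∫ z in ball c (2 * s), log⁺ ‖f z‖ ≤ π * (2 * s) ^ 2 * B := by
    rw [setIntegral_ball_eq_integral_circleAverage hv c (by positivity), ← hlin]
    refine intervalIntegral.integral_mono_on_of_le_Ioo (by positivity) (hint c _)
      (Continuous.intervalIntegrable (by fun_prop) _ _) fun ρ hρ ↦ ?_
    have := hB ρ hρ.1 hρ.2.le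
    have := hρ.1
    gcongr
  have h4 : π * s ^ 2 * log⁺ ‖f w‖ ≤ π * s ^ 2 * (4 * B) := by linarith
  exact le_of_mul_le_mul_left h4 (by positivity)

theorem circleAverage_posLog_norm_quotient_le {K M F : ℂ → ℂ} (hK : Differentiable ℂ K)
    (hM : Differentiable ℂ M) (hKMF : ∀ z, K z = M z * F z) {c : ℂ} (hc : M c ≠ 0) {B ρ : ℝ}
    (hρ : 0 < ρ) (hKB : ∀ z ∈ sphere c ρ, log⁺ ‖K z‖ ≤ B)
    (hMB : ∀ z ∈ sphere c ρ, log⁺ ‖M z‖ ≤ B) :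
    circleAverage (fun z ↦ log⁺ ‖F z‖) c ρ ≤ 2 * B - log ‖M c‖ := by
  have hm {f : ℂ → ℂ} (hf : Differentiable ℂ f) : MeromorphicOn f (sphere c |ρ|) :=
    fun z _ ↦ (hf.analyticAt z).meromorphicAt
  have hcod : (fun z ↦ log⁺ ‖F z‖) =ᶠ[codiscreteWithin (sphere c |ρ|)]
      fun z ↦ log⁺ ‖K z / M z‖ := by
    have : M ⁻¹' {0}ᶜ ∈ codiscrete ℂ :=
      AnalyticOnNhd.preimage_zero_mem_codiscrete (fun z _ ↦ hM.analyticAt z) hc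
    filter_upwards [codiscreteWithin_mono (subset_univ _) this] with z hz
    have : M z ≠ 0 := hz
    rw [hKMF z, mul_div_cancel_left₀ _ this]
  have hlogM : CircleIntegrable (fun z ↦ log ‖M z‖) c ρ := (hm hM).circleIntegrable_log_norm
  rw [circleAverage_congr_codiscreteWithin hcod hρ.ne']
  calc circleAverage (fun z ↦ log⁺ ‖K z / M z‖) c ρ
      ≤ circleAverage (fun z ↦ 2 * B - log ‖M z‖) c ρ := by
        refine circleAverage_mono ((hm hK).div (hm hM)).circleIntegrable_posLog_norm
          ((circleIntegrable_const _ _ _).sub hlogM) fun z hz ↦ ?_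
        rw [abs_of_pos hρ] at hz
        have h1 := hKB z hz
        have h2 := hMB z hz
        have h3 : log⁺ ‖K z / M z‖ ≤ log⁺ ‖K z‖ + log⁺ ‖M z‖⁻¹ := by
          rw [norm_div, div_eq_mul_inv]
          exact posLog_mul
        have h4 := posLog_sub_posLog_inv (x := ‖M z‖)
        linarith
    _ = 2 * B - circleAverage (fun z ↦ log ‖M z‖) c ρ := by
        rw [circleAverage_fun_sub (circleIntegrable_const _ _ _) hlogM, circleAverage_const]
    _ ≤ _ := by linarith [log_norm_le_circleAverage hM hρ hc]

/-- The quotient of two entire functions of exponential type, if entire, is of exponential type,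
and its type is controlled by that of the given functions. -/
theorem exists_norm_le_exp_of_mul_eq {K M F : ℂ → ℂ} (hK : Differentiable ℂ K)
    (hM : Differentiable ℂ M) (hF : Differentiable ℂ F) (hKMF : ∀ z, K z = M z * F z)
    (hM0 : ∃ c, M c ≠ 0) {a C : ℝ} (ha : 0 ≤ a) (hKa : ∀ z, ‖K z‖ ≤ C * rexp (a * ‖z‖))
    (hMa : ∀ z, ‖M z‖ ≤ C * rexp (a * ‖z‖)) :
    ∃ C', ∀ z, ‖F z‖ ≤ C' * rexp (16 * a * ‖z‖) := by
  obtain ⟨c, hc⟩ := hM0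
  have hlog {G : ℂ → ℂ} (hG : ∀ z, ‖G z‖ ≤ C * rexp (a * ‖z‖)) {ρ s : ℝ} (hρ : ρ ≤ 2 * s) (z : ℂ)
      (hz : z ∈ sphere c ρ) : log⁺ ‖G z‖ ≤ log⁺ C + a * (‖c‖ + 2 * s) := by
    have hz' : ‖z‖ ≤ ‖c‖ + 2 * s := by
      have h1 : ‖z - c‖ = ρ := by simpa [dist_eq_norm] using hz
      have h2 := norm_le_norm_add_norm_sub' z c
      linarith
    have h0 : 0 ≤ a * ‖z‖ := by positivity
    calc log⁺ ‖G z‖ ≤ log⁺ (C * rexp (a * ‖z‖)) := posLog_le_posLog (norm_nonneg _) (hG z)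
      _ ≤ log⁺ C + log⁺ (rexp (a * ‖z‖)) := posLog_mul
      _ = log⁺ C + a * ‖z‖ := by rw [posLog_apply (x := rexp _), log_exp, max_eq_right h0]
      _ ≤ _ := by gcongr
  refine ⟨rexp (4 * (2 * (log⁺ C + a * (3 * ‖c‖ + 2)) - log ‖M c‖)), fun w ↦ ?_⟩
  have key := posLog_norm_le_of_circleAverage_le hF (c := c) (w := w) (s := ‖w‖ + ‖c‖ + 1)
    (by positivity) (by linarith [norm_sub_le w c]) fun ρ hρ hρs ↦
      circleAverage_posLog_norm_quotient_le hK hM hKMF hc hρ (hlog hKa hρs) (hlog hMa hρs)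
  have h0 : ‖F w‖ ≤ rexp (log⁺ ‖F w‖) := by
    rcases eq_or_ne (F w) 0 with h | h
    · simp [h]
    · calc ‖F w‖ = rexp (log ‖F w‖) := (exp_log (norm_pos_iff.2 h)).symm
        _ ≤ _ := exp_le_exp.2 (le_max_right _ _)
  refine h0.trans ?_
  rw [← Real.exp_add]
  refine exp_le_exp.2 (key.trans (le_of_eq ?_))
  ring
end

section
open Metric Set MeasureTheory Real Filter Topology

theorem norm_le_of_norm_le_on_diagonals {f : ℂ → ℂ} (hf : Differentiable ℂ f) {A B C : ℝ}
    (hexp : ∀ z, ‖f z‖ ≤ C * rexp (A * ‖z‖)) (hB : ∀ z : ℂ, |z.re| = |z.im| → ‖f z‖ ≤ B) (z : ℂ) :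
    ‖f z‖ ≤ B := by
  set ω : ℂ := 1 + Complex.I
  have hω : ω ≠ 0 := fun h ↦ by simpa [ω] using congrArg Complex.re h
  have hg : Differentiable ℂ fun z ↦ f (ω * z) := by fun_prop
  have hO (s : Set ℂ) : ∃ c < (2 : ℝ), ∃ b, (fun z ↦ f (ω * z)) =O[Bornology.cobounded ℂ ⊓ 𝓟 s]
      fun z ↦ rexp (b * ‖z‖ ^ c) := by
    refine ⟨1, by norm_num, A * ‖ω‖, Asymptotics.IsBigO.of_bound C
      (Eventually.of_forall fun z ↦ ?_)⟩
    simpa [mul_assoc] using hexp (ω * z)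
  have hre (x : ℝ) : ‖f (ω * x)‖ ≤ B := hB _ (by simp [ω])
  have him (x : ℝ) : ‖f (ω * (x * Complex.I))‖ ≤ B := hB _ (by simp [ω])
  obtain ⟨z, rfl⟩ : ∃ z', ω * z' = z := ⟨z / ω, mul_div_cancel₀ z hω⟩
  rcases le_total 0 z.re with h1 | h1 <;> rcases le_total 0 z.im with h2 | h2
  · exact PhragmenLindelof.quadrant_I (f := fun z ↦ f (ω * z)) hg.diffContOnCl (hO _)
      (fun x _ ↦ hre x)
      (fun x _ ↦ him x) h1 h2
  · exact PhragmenLindelof.quadrant_IV (f := fun z ↦ f (ω * z)) hg.diffContOnCl (hO _)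
      (fun x _ ↦ hre x)
      (fun x _ ↦ him x) h1 h2
  · exact PhragmenLindelof.quadrant_II (f := fun z ↦ f (ω * z)) hg.diffContOnCl (hO _)
      (fun x _ ↦ hre x)
      (fun x _ ↦ him x) h1 h2
  · exact PhragmenLindelof.quadrant_III (f := fun z ↦ f (ω * z)) hg.diffContOnCl (hO _)
      (fun x _ ↦ hre x)
      (fun x _ ↦ him x) h1 h2

theorem norm_truncatedLaplace_le {w : ℝ → ℂ} (hw : Continuous w) {t : ℝ} {z : ℂ}
    (h : 0 ≤ t * z.re) :
    ‖∫ u in 0..t, w u * Complex.exp (-z * u)‖ ≤ |∫ u in 0..t, ‖w u‖| := by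
  refine intervalIntegral.norm_integral_le_abs_of_norm_le (ae_restrict_of_forall_mem
    measurableSet_uIoc fun u hu ↦ ?_) (hw.norm.intervalIntegrable _ _)
  rw [norm_mul, Complex.norm_exp]
  refine mul_le_of_le_one_right (norm_nonneg _) (exp_le_one_iff.2 ?_)
  have : 0 ≤ z.re * u := by
    rcases mem_uIoc.1 hu with ⟨h1, h2⟩ | ⟨h1, h2⟩
    · exact mul_nonneg (by nlinarith) h1.le
    · exact mul_nonneg_of_nonpos_of_nonpos (by nlinarith) h2
  simpa using this

theorem tendsto_truncatedLaplace_atTop {w : ℝ → ℂ} (hw : Continuous w) {t : ℝ} (ht : 0 ≤ t) :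
    Tendsto (fun x : ℝ ↦ ∫ u in 0..t, w u * Complex.exp (-x * u)) atTop (𝓝 0) := by
  have h0 : ∫ u in 0..t, (0 : ℂ) = 0 := by simp
  rw [← h0]
  refine intervalIntegral.tendsto_integral_filter_of_dominated_convergence (fun u ↦ ‖w u‖) ?_ ?_
    (hw.norm.intervalIntegrable _ _) ?_
  · exact Eventually.of_forall fun x ↦ Continuous.aestronglyMeasurable (by fun_prop)
  · filter_upwards [eventually_ge_atTop 0] with x hx
    refine Eventually.of_forall fun u hu ↦ ?_
    rw [uIoc_of_le ht] at hu
    rw [norm_mul, Complex.norm_exp]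
    refine mul_le_of_le_one_right (norm_nonneg _) (exp_le_one_iff.2 ?_)
    have : 0 ≤ x * u := mul_nonneg hx hu.1.le
    simpa using this
  · refine Eventually.of_forall fun u hu ↦ ?_
    rw [uIoc_of_le ht] at hu
    rw [tendsto_zero_iff_norm_tendsto_zero]
    have : Tendsto (fun x : ℝ ↦ ‖w u‖ * rexp (-(x * u))) atTop (𝓝 (‖w u‖ * 0)) :=
      (tendsto_exp_neg_atTop_nhds_zero.comp (tendsto_id.atTop_mul_const hu.1)).const_mul _
    simpa [Complex.norm_exp] using this

/-- An entire function all of whose "translates" `W t` are of exponential type, uniformly in `t`,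
vanishes. -/
theorem eq_zero_of_forall_eq_truncatedLaplace_add {w : ℝ → ℂ} (hw : Continuous w) {F : ℂ → ℂ}
    (hF : Differentiable ℂ F) {W : ℝ → ℂ → ℂ} {A : ℝ}
    (hW : ∀ t, ∃ C, ∀ z, ‖W t z‖ ≤ C * rexp (A * ‖z‖))
    (hFW : ∀ t z, F z = (∫ u in 0..t, w u * Complex.exp (-z * u)) + Complex.exp (-z * t) * W t z)
    (z : ℂ) : F z = 0 := by
  wlog hA : 0 ≤ A generalizing A
  · refine this (A := 0) (fun t ↦ ?_) le_rfl
    obtain ⟨C, hC⟩ := hW t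
    refine ⟨C, fun z ↦ (hC z).trans ?_⟩
    have : 0 ≤ C := by simpa using (norm_nonneg _).trans (hC 0)
    gcongr
    linarith
  have hterm (t : ℝ) : ∃ C, 0 ≤ C ∧ ∀ z, ‖Complex.exp (-z * t) * W t z‖ ≤
      C * rexp (A * ‖z‖ - t * z.re) := by
    obtain ⟨C, hC⟩ := hW t
    refine ⟨C, by simpa using (norm_nonneg _).trans (hC 0), fun z ↦ ?_⟩
    rw [norm_mul, Complex.norm_exp, sub_eq_add_neg, Real.exp_add, ← mul_assoc, mul_comm]
    have : (-z * t).re = -(t * z.re) := by simp [mul_comm]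
    rw [this]
    gcongr
    exact hC z
  have hexp : ∃ C, ∀ z, ‖F z‖ ≤ C * rexp (A * ‖z‖) := by
    obtain ⟨C, hC⟩ := hW 0
    exact ⟨C, fun z ↦ by simpa [hFW 0 z] using hC z⟩
  obtain ⟨C, hexp⟩ := hexp
  obtain ⟨C₁, h1, hC₁⟩ := hterm (2 * A)
  obtain ⟨C₂, h2, hC₂⟩ := hterm (-(2 * A))
  have hdiag {z : ℂ} (hz : |z.re| = |z.im|) : A * ‖z‖ - 2 * A * |z.re| ≤ 0 := by
    have := Complex.norm_le_abs_re_add_abs_im z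
    nlinarith
  have hbdd := norm_le_of_norm_le_on_diagonals hF hexp
    (B := max (|∫ u in 0..(2 * A), ‖w u‖| + C₁) (|∫ u in 0..(-(2 * A)), ‖w u‖| + C₂))
    fun z hz ↦ ?_
  · have hconst (z : ℂ) : F z = F 0 :=
      hF.apply_eq_apply_of_bounded (isBounded_iff_forall_norm_le.2
        ⟨_, by rintro _ ⟨z, rfl⟩; exact hbdd z⟩) z 0
    obtain ⟨C₃, h3, hC₃⟩ := hterm (A + 1)
    have hlim : Tendsto (fun x : ℝ ↦ F x) atTop (𝓝 (0 + 0)) := by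
      simp_rw [hFW (A + 1)]
      refine (tendsto_truncatedLaplace_atTop hw (by positivity)).add ?_
      refine squeeze_zero_norm' (a := fun x ↦ C₃ * rexp (-x)) ?_ ?_
      · filter_upwards [eventually_ge_atTop 0] with x hx
        refine (hC₃ x).trans (le_of_eq ?_)
        simp only [Complex.norm_real, norm_eq_abs, abs_of_nonneg hx, Complex.ofReal_re]
        ring_nf
      · simpa using tendsto_exp_neg_atTop_nhds_zero.const_mul C₃
    simp_rw [hconst] at hlim ⊢
    simpa using tendsto_nhds_unique tendsto_const_nhds hlim
  · rcases le_total 0 z.re with h | h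
    · refine le_max_of_le_left ?_
      rw [hFW (2 * A) z]
      refine norm_add_le_of_le (norm_truncatedLaplace_le hw (by positivity)) ?_
      refine (hC₁ z).trans (mul_le_of_le_one_right h1 (exp_le_one_iff.2 ?_))
      simpa [abs_of_nonneg h] using hdiag hz
    · refine le_max_of_le_right ?_
      rw [hFW (-(2 * A)) z]
      refine norm_add_le_of_le (norm_truncatedLaplace_le hw (by nlinarith)) ?_
      refine (hC₂ z).trans (mul_le_of_le_one_right h2 (exp_le_one_iff.2 ?_))
      simpa [abs_of_nonpos h] using hdiag hz

/-- If the order of vanishing of `M` nowhere exceeds that of `N`, then `N / M` is entire. -/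
theorem exists_differentiable_mul_eq {M N : ℂ → ℂ} (hM : Differentiable ℂ M)
    (hN : Differentiable ℂ N) (hM0 : ∃ c, M c ≠ 0)
    (h : ∀ z, analyticOrderAt M z ≤ analyticOrderAt N z) :
    ∃ F : ℂ → ℂ, Differentiable ℂ F ∧ ∀ z, N z = M z * F z := by
  have hQ : MeromorphicOn (N / M) univ := fun z _ ↦
    (hN.analyticAt z).meromorphicAt.div (hM.analyticAt z).meromorphicAt
  have htop (z : ℂ) : analyticOrderAt M z ≠ ⊤ := by
    obtain ⟨c, hc⟩ := hM0
    intro hz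
    refine hc ?_
    have := AnalyticOnNhd.eqOn_zero_of_preconnected_of_eventuallyEq_zero
      (fun z _ ↦ hM.analyticAt z) isPreconnected_univ (mem_univ z) (analyticOrderAt_eq_top.1 hz)
    exact this (mem_univ c)
  set F := toMeromorphicNFOn (N / M) univ
  have hF : MeromorphicNFOn F univ := meromorphicNFOn_toMeromorphicNFOn _ _
  have hFan (z : ℂ) : AnalyticAt ℂ F z := by
    rw [← (hF (mem_univ z)).meromorphicOrderAt_nonneg_iff_analyticAt,
      meromorphicOrderAt_toMeromorphicNFOn hQ (mem_univ z), meromorphicOrderAt_div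
      (hN.analyticAt z).meromorphicAt (hM.analyticAt z).meromorphicAt,
      (hN.analyticAt z).meromorphicOrderAt_eq, (hM.analyticAt z).meromorphicOrderAt_eq]
    have hz := h z
    lift analyticOrderAt M z to ℕ using htop z with m
    cases hn : analyticOrderAt N z with
    | top => simp
    | coe n =>
      rw [hn] at hz
      have : m ≤ n := by exact_mod_cast hz
      simp only [ENat.map_natCast]
      norm_cast
      grind
  have hFd : Differentiable ℂ F := fun z ↦ (hFan z).differentiableAt
  refine ⟨F, hFd, fun z ↦ ?_⟩
  have hMz : ∀ᶠ y in 𝓝[≠] z, M y ≠ 0 :=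
    (hM.analyticAt z).eventually_eq_zero_or_eventually_ne_zero.resolve_left
      fun h ↦ htop z (analyticOrderAt_eq_top.2 h)
  have hFz : F =ᶠ[𝓝[≠] z] N / M := hQ.toMeromorphicNFOn_eq_self_on_nhdsNE (mem_univ z)
  have hev : N =ᶠ[𝓝[≠] z] fun y ↦ M y * F y := by
    filter_upwards [hMz, hFz] with y h1 h2
    rw [h2, Pi.div_apply, mul_div_cancel₀ _ h1]
  exact tendsto_nhds_unique (hN.continuous.continuousAt.tendsto.mono_left nhdsWithin_le_nhds)
    (((hM.continuous.mul hFd.continuous).continuousAt.tendsto.mono_left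
      nhdsWithin_le_nhds).congr' hev.symm)
end

noncomputable section

open Set MeasureTheory Filter Topology

theorem Submodule.exists_continuousLinearMap_of_notMem_closure {E : Type*} [AddCommGroup E]
    [Module ℂ E] [TopologicalSpace E] [IsTopologicalAddGroup E] [ContinuousSMul ℂ E]
    [Module ℝ E] [IsScalarTower ℝ ℂ E] [LocallyConvexSpace ℝ E] {S : Submodule ℂ E} {x : E}
    (hx : x ∉ closure (S : Set E)) : ∃ φ : E →L[ℂ] ℂ, (∀ y ∈ S, φ y = 0) ∧ φ x ≠ 0 := by
  have : ContinuousSMul ℝ E := IsScalarTower.continuousSMul ℂ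
  rw [← S.topologicalClosure_coe] at hx
  obtain ⟨φ, u, hu, hux⟩ := RCLike.geometric_hahn_banach_closed_point (𝕜 := ℂ)
    (S.topologicalClosure.restrictScalars ℝ).convex S.isClosed_topologicalClosure hx
  have h0 : 0 < u := by simpa using hu 0 (zero_mem _)
  have hS (y : E) (hy : y ∈ S) : φ y = 0 := by
    by_contra hne
    have := hu (((u : ℂ) / φ y) • y) (S.le_topologicalClosure (S.smul_mem _ hy))
    simp [hne] at this
  refine ⟨φ, hS, fun h ↦ ?_⟩
  rw [h] at hux
  simp at hux
  linarith

namespace ContinuousMap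

/-- A continuous linear functional on `C(ℝ, ℂ)` is supported in a compact interval. -/
theorem exists_eq_comp_restrict (φ : C(ℝ, ℂ) →L[ℂ] ℂ) :
    ∃ R : ℝ, 0 ≤ R ∧ ∃ ψ : C(Icc (-R) R, ℂ) →L[ℂ] ℂ, ∀ f, φ f = ψ (f.restrict (Icc (-R) R)) := by
  have hmem : {f : C(ℝ, ℂ) | ‖φ f‖ < 1} ∈ 𝓝 (const ℝ (0 : ℂ)) := by
    refine (isOpen_lt (by fun_prop) continuous_const).mem_nhds ?_
    simp
  obtain ⟨⟨K, ε⟩, ⟨hK, hε⟩, hsub⟩ := Metric.nhds_basis_ball.nhds_continuousMapConst.mem_iff.1 hmem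
  obtain ⟨R, hR⟩ := hK.isBounded.subset_closedBall 0
  have hKR : K ⊆ Icc (-|R|) |R| := fun x hx ↦ abs_le.1 <| by
    simpa using (Metric.mem_closedBall.1 (hR hx)).trans (le_abs_self R)
  have hker (f : C(ℝ, ℂ)) (hf : ∀ x ∈ K, f x = 0) : φ f = 0 := by
    by_contra hne
    have := @hsub ((φ f)⁻¹ • f) (fun x hx ↦ by simpa [hf x hx] using hε)
    simp [hne] at this
  have hle : -|R| ≤ |R| := by linarith [abs_nonneg R]
  refine ⟨|R|, abs_nonneg R,
    φ.comp (compCLM ℂ ℂ (⟨projIcc _ _ hle, continuous_projIcc⟩ : C(ℝ, Icc (-|R|) |R|))),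
    fun f ↦ ?_⟩
  rw [← sub_eq_zero, ContinuousLinearMap.comp_apply, ← map_sub]
  refine hker _ fun x hx ↦ ?_
  simp [projIcc_of_mem hle (hKR hx)]

theorem map_eq_intervalIntegral (φ : C(ℝ, ℂ) →L[ℂ] ℂ) {H : ℝ → C(ℝ, ℂ)} (hH : Continuous H)
    {a b : ℝ} {g : C(ℝ, ℂ)} (hg : ∀ y, g y = ∫ x in a..b, H x y) :
    φ g = ∫ x in a..b, φ (H x) := by
  obtain ⟨R, -, ψ, hψ⟩ := exists_eq_comp_restrict φ
  have hHR : Continuous fun x ↦ (H x).restrict (Icc (-R) R) := (continuous_restrict _).comp hH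
  simp_rw [hψ]
  rw [ψ.intervalIntegral_comp_comm (hHR.intervalIntegrable (μ := volume) _ _)]
  congr 1
  ext y
  have := (evalCLM ℂ y).intervalIntegral_comp_comm (hHR.intervalIntegrable (μ := volume) a b)
  simpa [hg] using this

theorem differentiable_of_forall_apply {K : Type*} [TopologicalSpace K] [CompactSpace K]
    {H : ℂ → C(K, ℂ)} (hc : Continuous H) (hd : ∀ x, Differentiable ℂ fun z ↦ H z x) :
    Differentiable ℂ H := by
  intro z
  have hci : CircleIntegrable H z 1 := hc.continuousOn.circleIntegrable zero_le_one
  have hps := (hasFPowerSeriesOn_cauchy_integral (R := 1) hci one_pos).analyticAt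
  refine hps.differentiableAt.congr_of_eventuallyEq ?_
  filter_upwards [Metric.ball_mem_nhds z one_pos] with w hw
  ext x
  have hw' : ∀ y ∈ Metric.sphere z 1, y - w ≠ 0 := fun y hy h ↦ by
    rw [sub_eq_zero] at h
    rw [Metric.mem_ball, ← h, Metric.mem_sphere.1 hy] at hw
    exact lt_irrefl _ hw
  have hint : CircleIntegrable (fun y ↦ (y - w)⁻¹ • H y) z 1 :=
    ContinuousOn.circleIntegrable zero_le_one
      (((by fun_prop : Continuous fun y : ℂ ↦ y - w).continuousOn.inv₀ hw').smul hc.continuousOn)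
  have h1 := (evalCLM ℂ x).intervalIntegral_comp_comm hint.out
  have h2 := Complex.two_pi_I_inv_smul_circleIntegral_sub_inv_smul_of_differentiable_on_off_countable
    countable_empty hw (hd x).continuous.continuousOn fun y _ ↦ hd x y
  rw [← h2]
  exact congrArg ((2 * Real.pi * Complex.I : ℂ)⁻¹ • ·) h1

/-- A continuous linear functional maps holomorphic families to holomorphic functions. -/
theorem differentiable_map (φ : C(ℝ, ℂ) →L[ℂ] ℂ) {h : ℂ → C(ℝ, ℂ)} (hc : Continuous h)
    (hd : ∀ x, Differentiable ℂ fun z ↦ h z x) : Differentiable ℂ fun z ↦ φ (h z) := by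
  obtain ⟨R, -, ψ, hψ⟩ := exists_eq_comp_restrict φ
  simp_rw [hψ]
  exact ψ.differentiable.comp
    (differentiable_of_forall_apply ((continuous_restrict _).comp hc) fun x ↦ hd x)

theorem hasDerivAt_map (φ : C(ℝ, ℂ) →L[ℂ] ℂ) {h : ℂ → C(ℝ, ℂ)} (hc : Continuous h)
    {k : ℂ → C(ℝ, ℂ)} (hd : ∀ x z, HasDerivAt (fun z ↦ h z x) (k z x) z) (z : ℂ) :
    HasDerivAt (fun z ↦ φ (h z)) (φ (k z)) z := by
  obtain ⟨R, -, ψ, hψ⟩ := exists_eq_comp_restrict φ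
  simp_rw [hψ]
  have hH : HasDerivAt (fun z ↦ (h z).restrict (Icc (-R) R)) _ z := (differentiable_of_forall_apply
    ((continuous_restrict _).comp hc) (fun x z ↦ (hd x z).differentiableAt) z).hasDerivAt
  have hk : (k z).restrict (Icc (-R) R) = deriv (fun z ↦ (h z).restrict (Icc (-R) R)) z := by
    ext x
    have := (evalCLM ℂ x : C(Icc (-R) R, ℂ) →L[ℂ] ℂ).hasFDerivAt.comp_hasDerivAt z hH
    exact (hd x z).unique this
  rw [hk]
  exact ψ.hasFDerivAt.comp_hasDerivAt z hH

/-- The exponential monomial `x ↦ x ^ k * exp (z * x)`. -/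
def expMonomial (k : ℕ) (z : ℂ) : C(ℝ, ℂ) :=
  ⟨fun x ↦ (x : ℂ) ^ k * Complex.exp (z * x), by fun_prop⟩

@[simp]
theorem expMonomial_apply (k : ℕ) (z : ℂ) (x : ℝ) :
    expMonomial k z x = (x : ℂ) ^ k * Complex.exp (z * x) := rfl

theorem continuous_expMonomial (k : ℕ) : Continuous (expMonomial k) :=
  continuous_of_continuous_uncurry _ (by
    simp only [Function.uncurry_def, expMonomial_apply]; fun_prop)

/-- A continuous linear functional is determined by its Fourier-Laplace transform. -/
theorem eq_zero_of_map_expMonomial_eq_zero {φ : C(ℝ, ℂ) →L[ℂ] ℂ}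
    (h : ∀ z, φ (expMonomial 0 z) = 0) : φ = 0 := by
  obtain ⟨R, -, ψ, hψ⟩ := exists_eq_comp_restrict φ
  let e (r : ℝ) : C(Icc (-R) R, ℂ) := (expMonomial 0 (r * Complex.I)).restrict _
  have he (r : ℝ) (x) : e r x = Complex.exp (r * Complex.I * (x : ℝ)) := by simp [e]
  let A : StarSubalgebra ℂ C(Icc (-R) R, ℂ) :=
    { toSubalgebra := Algebra.adjoin ℂ (range e)
      star_mem' := by
        change Algebra.adjoin ℂ (range e) ≤ star (Algebra.adjoin ℂ (range e))
        refine Algebra.adjoin_le ?_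
        rintro - ⟨r, rfl⟩
        refine Algebra.subset_adjoin ⟨-r, ?_⟩
        ext x
        simp [he, ← Complex.exp_conj] }
  have hA : Subalgebra.toSubmodule A.toSubalgebra = Submodule.span ℂ (range e) := by
    refine Algebra.adjoin_eq_span_of_subset _ (Subset.trans (fun x hx ↦ ?_) Submodule.subset_span)
    refine Submonoid.closure_induction (fun _ ↦ id) ⟨0, ?_⟩ ?_ hx
    · ext x
      simp [he]
    · rintro - - - - ⟨r, rfl⟩ ⟨s, rfl⟩
      refine ⟨r + s, ?_⟩
      ext x
      simp [he, ← Complex.exp_add, add_mul]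
  have hdense : A.topologicalClosure = ⊤ := by
    refine starSubalgebra_topologicalClosure_eq_top_of_separatesPoints A fun x y hxy ↦ ?_
    have hd : ((x : ℝ) : ℂ) - (y : ℝ) ≠ 0 :=
      sub_ne_zero.2 fun hc ↦ hxy (Subtype.ext (by exact_mod_cast hc))
    refine ⟨_, ⟨e (Real.pi / (x - y)), Algebra.subset_adjoin ⟨_, rfl⟩, rfl⟩, fun heq ↦ ?_⟩
    change e _ x = e _ y at heq
    have hx : ((Real.pi / (x - y) : ℝ) : ℂ) * Complex.I * (x : ℝ) =
        ((Real.pi / (x - y) : ℝ) : ℂ) * Complex.I * (y : ℝ) + Real.pi * Complex.I := by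
      push_cast
      field_simp
      ring
    rw [he, he, hx, Complex.exp_add, Complex.exp_pi_mul_I, mul_neg_one, neg_eq_self] at heq
    exact Complex.exp_ne_zero _ heq
  have hψA (g) (hg : g ∈ A) : ψ g = 0 := by
    have hg' : g ∈ Submodule.span ℂ (range e) := hA ▸ hg
    have : Submodule.span ℂ (range e) ≤ ψ.ker := by
      rw [Submodule.span_le]
      rintro - ⟨r, rfl⟩
      exact (hψ _).symm.trans (h _)
    exact this hg'
  ext f
  have hmem : f.restrict (Icc (-R) R) ∈ A.topologicalClosure := hdense ▸ StarSubalgebra.mem_top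
  rw [hψ]
  exact closure_minimal hψA ψ.isClosed_ker hmem

/-- The translate `y ↦ f (y + x)`. -/
def translate (f : C(ℝ, ℂ)) (x : ℝ) : C(ℝ, ℂ) := ⟨fun y ↦ f (y + x), by fun_prop⟩

@[simp]
theorem translate_apply (f : C(ℝ, ℂ)) (x y : ℝ) : f.translate x y = f (y + x) := rfl

theorem continuous_translate : Continuous fun p : C(ℝ, ℂ) × ℝ ↦ p.1.translate p.2 := by
  refine continuous_of_continuous_uncurry _ ?_
  simp only [Function.uncurry_def, translate_apply]
  fun_prop

/-- The convolution `x ↦ φ (f (· + x))` of a function with a functional. -/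
def conv (φ : C(ℝ, ℂ) →L[ℂ] ℂ) : C(ℝ, ℂ) →L[ℂ] C(ℝ, ℂ) where
  toFun f := ⟨fun x ↦ φ (f.translate x),
    φ.continuous.comp (continuous_translate.comp (by fun_prop : Continuous fun x ↦ (f, x)))⟩
  map_add' f g := by ext x; exact map_add φ (f.translate x) (g.translate x)
  map_smul' c f := by ext x; exact map_smul φ c (f.translate x)
  cont := continuous_of_continuous_uncurry _ (φ.continuous.comp continuous_translate)

@[simp]
theorem conv_apply (φ : C(ℝ, ℂ) →L[ℂ] ℂ) (f : C(ℝ, ℂ)) (x : ℝ) :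
    conv φ f x = φ (f.translate x) := rfl

theorem conv_expMonomial_zero (φ : C(ℝ, ℂ) →L[ℂ] ℂ) (z : ℂ) :
    conv φ (expMonomial 0 z) = φ (expMonomial 0 z) • expMonomial 0 z := by
  ext x
  have : (expMonomial 0 z).translate x = Complex.exp (z * x) • expMonomial 0 z := by
    ext y
    simp [mul_add, Complex.exp_add, mul_comm]
  rw [conv_apply, this]
  simp [mul_comm]

/-- Fubini's theorem for functionals. -/
theorem map_conv_comm (φ ψ : C(ℝ, ℂ) →L[ℂ] ℂ) (f : C(ℝ, ℂ)) : φ (conv ψ f) = ψ (conv φ f) := by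
  have : φ.comp (conv ψ) - ψ.comp (conv φ) = 0 := eq_zero_of_map_expMonomial_eq_zero fun z ↦ by
    simp [conv_expMonomial_zero, mul_comm]
  exact sub_eq_zero.1 (DFunLike.congr_fun this f)

theorem conv_translate (φ : C(ℝ, ℂ) →L[ℂ] ℂ) (f : C(ℝ, ℂ)) (t : ℝ) :
    conv φ (f.translate t) = (conv φ f).translate t := by
  ext x
  simp only [conv_apply, translate_apply]
  congr 1
  ext y
  simp [add_assoc]

/-- The exponential convolution `y ↦ ∫ u in 0..y, f u * exp (z * (y - u))`. -/
def expConv (f : C(ℝ, ℂ)) (z : ℂ) : C(ℝ, ℂ) :=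
  ⟨fun y ↦ ∫ u in 0..y, f u * Complex.exp (z * (y - u)), by fun_prop⟩

theorem expConv_apply (f : C(ℝ, ℂ)) (z : ℂ) (y : ℝ) :
    expConv f z y = ∫ u in 0..y, f u * Complex.exp (z * (y - u)) := rfl

theorem continuous_expConv (f : C(ℝ, ℂ)) : Continuous (expConv f) := by
  refine continuous_of_continuous_uncurry _ ?_
  simp only [Function.uncurry_def, expConv_apply]
  fun_prop

theorem expConv_eq_mul (f : C(ℝ, ℂ)) (z : ℂ) (t : ℝ) :
    expConv f z t = Complex.exp (z * t) * ∫ u in 0..t, f u * Complex.exp (-z * u) := by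
  rw [expConv_apply, ← intervalIntegral.integral_const_mul]
  congr 1 with u
  rw [mul_left_comm, ← Complex.exp_add]
  ring_nf

theorem differentiable_truncatedLaplace {w : ℝ → ℂ} (hw : Continuous w) (t : ℝ) :
    Differentiable ℂ fun z : ℂ ↦ ∫ u in 0..t, w u * Complex.exp (-z * u) := by
  intro z
  refine (intervalIntegral.hasDerivAt_integral_of_dominated_loc_of_deriv_le
    (F' := fun z u ↦ w u * (Complex.exp (-z * u) * (-u)))
    (bound := fun u ↦ ‖w u‖ * (Real.exp ((‖z‖ + 1) * |u|) * |u|))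
    (Metric.ball_mem_nhds z one_pos) (Eventually.of_forall fun x ↦ ?_)
    ?_ ?_ ?_ ?_ ?_).2.differentiableAt
  · exact Continuous.aestronglyMeasurable (by fun_prop)
  · exact Continuous.intervalIntegrable (by fun_prop) _ _
  · exact Continuous.aestronglyMeasurable (by fun_prop)
  · refine Eventually.of_forall fun u _ x hx ↦ ?_
    rw [norm_mul, norm_mul, Complex.norm_exp, norm_neg, Complex.norm_real, Real.norm_eq_abs]
    gcongr
    refine (Complex.re_le_norm _).trans ?_
    rw [norm_mul, norm_neg, Complex.norm_real, Real.norm_eq_abs]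
    gcongr
    have := norm_sub_norm_le x z
    rw [Metric.mem_ball, dist_eq_norm] at hx
    linarith
  · exact Continuous.intervalIntegrable (by fun_prop) _ _
  · refine Eventually.of_forall fun u _ x _ ↦ ?_
    have := (((hasDerivAt_id x).neg.mul_const (u : ℂ)).cexp).const_mul (w u)
    simpa using this

theorem differentiable_expConv (f : C(ℝ, ℂ)) (y : ℝ) : Differentiable ℂ fun z ↦ expConv f z y := by
  simp_rw [expConv_eq_mul]
  exact (by fun_prop : Differentiable ℂ fun z : ℂ ↦ Complex.exp (z * y)).mul
    (differentiable_truncatedLaplace f.continuous y)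

theorem expConv_add (f : C(ℝ, ℂ)) (z : ℂ) (y t : ℝ) :
    expConv f z (y + t) = Complex.exp (z * y) * expConv f z t + expConv (f.translate t) z y := by
  have hint (a b : ℝ) : IntervalIntegrable (fun u ↦ f u * Complex.exp (-z * u)) volume a b :=
    Continuous.intervalIntegrable (by fun_prop) _ _
  have hsub := intervalIntegral.integral_comp_add_right (a := 0) (b := y)
    (fun u ↦ f u * Complex.exp (-z * u)) t
  have hfac : ∫ u in 0..y, f (u + t) * Complex.exp (-z * ↑(u + t)) =
      Complex.exp (-z * t) * ∫ u in 0..y, f (u + t) * Complex.exp (-z * u) := by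
    rw [← intervalIntegral.integral_const_mul]
    congr 1 with u
    rw [mul_left_comm, ← Complex.exp_add]
    push_cast
    ring_nf
  rw [hfac, zero_add] at hsub
  simp only [expConv_eq_mul, translate_apply]
  rw [← intervalIntegral.integral_add_adjacent_intervals (hint 0 t) (hint t (y + t)), ← hsub]
  have h1 : Complex.exp (z * ↑(y + t)) = Complex.exp (z * y) * Complex.exp (z * t) := by
    rw [← Complex.exp_add]
    push_cast
    ring_nf
  have h2 : Complex.exp (z * t) * Complex.exp (-z * t) = 1 := by
    rw [← Complex.exp_add]
    simp
  rw [h1]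
  linear_combination Complex.exp (z * y) *
    (∫ u in 0..y, f (u + t) * Complex.exp (-z * u)) * h2

theorem hasDerivAt_map_expMonomial (φ : C(ℝ, ℂ) →L[ℂ] ℂ) (k : ℕ) (z : ℂ) :
    HasDerivAt (fun z ↦ φ (expMonomial k z)) (φ (expMonomial (k + 1) z)) z := by
  refine hasDerivAt_map φ (continuous_expMonomial k) (k := expMonomial (k + 1)) (fun x z ↦ ?_) z
  have := (((hasDerivAt_id z).mul_const (x : ℂ)).cexp).const_mul ((x : ℂ) ^ k)
  simpa [pow_succ, mul_assoc, mul_comm, mul_left_comm] using this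

theorem differentiable_map_expMonomial (φ : C(ℝ, ℂ) →L[ℂ] ℂ) (k : ℕ) :
    Differentiable ℂ fun z ↦ φ (expMonomial k z) :=
  fun z ↦ (hasDerivAt_map_expMonomial φ k z).differentiableAt

theorem differentiable_map_expConv (φ : C(ℝ, ℂ) →L[ℂ] ℂ) (f : C(ℝ, ℂ)) :
    Differentiable ℂ fun z ↦ φ (expConv f z) :=
  differentiable_map φ (continuous_expConv f) (differentiable_expConv f)

theorem iteratedDeriv_map_expMonomial (φ : C(ℝ, ℂ) →L[ℂ] ℂ) (k : ℕ) :
    iteratedDeriv k (fun z ↦ φ (expMonomial 0 z)) = fun z ↦ φ (expMonomial k z) := by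
  induction k with
  | zero => simp
  | succ k ih =>
    rw [iteratedDeriv_succ, ih]
    exact funext fun z ↦ (hasDerivAt_map_expMonomial φ k z).deriv

theorem exists_norm_map_le_exp (φ : C(ℝ, ℂ) →L[ℂ] ℂ) :
    ∃ a : ℝ, 0 ≤ a ∧ ∀ f : C(ℝ, ℂ), ∃ C, ∀ z,
      ‖φ (expMonomial 0 z)‖ ≤ C * Real.exp (a * ‖z‖) ∧
      ‖φ (expConv f z)‖ ≤ C * Real.exp (a * ‖z‖) := by
  obtain ⟨R, hR, ψ, hψ⟩ := exists_eq_comp_restrict φ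
  have hexp (z : ℂ) {y : ℝ} (hy : |y| ≤ R) : ‖Complex.exp (z * y)‖ ≤ Real.exp (R * ‖z‖) := by
    rw [Complex.norm_exp]
    gcongr
    refine (Complex.re_le_norm _).trans ?_
    rw [norm_mul, Complex.norm_real, Real.norm_eq_abs, mul_comm]
    gcongr
  refine ⟨R, hR, fun f ↦ ⟨‖ψ‖ * max 1 (‖f.restrict (Icc (-R) R)‖ * R), fun z ↦ ⟨?_, ?_⟩⟩⟩
  · rw [hψ, mul_assoc]
    refine (ψ.le_opNorm _).trans ?_
    gcongr
    rw [ContinuousMap.norm_le _ (by positivity)]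
    intro y
    calc _ = ‖Complex.exp (z * (y : ℝ))‖ := by simp
      _ ≤ 1 * Real.exp (R * ‖z‖) := by simpa only [one_mul] using hexp z (abs_le.2 y.2)
      _ ≤ _ := by gcongr; exact le_max_left _ _
  · rw [hψ, mul_assoc]
    refine (ψ.le_opNorm _).trans ?_
    gcongr
    rw [ContinuousMap.norm_le _ (by positivity)]
    intro y
    have hy : |(y : ℝ)| ≤ R := abs_le.2 y.2
    calc _ = ‖∫ u in 0..(y : ℝ), f u * Complex.exp (z * ((y : ℝ) - u))‖ := rfl
      _ ≤ (‖f.restrict (Icc (-R) R)‖ * Real.exp (R * ‖z‖)) * |(y : ℝ) - 0| := by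
        refine intervalIntegral.norm_integral_le_of_norm_le_const fun u hu ↦ ?_
        have hu' : |u| ≤ R ∧ |(y : ℝ) - u| ≤ R := by
          simp only [abs_le] at hy ⊢
          rcases mem_uIoc.1 hu with h | h <;> refine ⟨⟨?_, ?_⟩, ?_, ?_⟩ <;> linarith
        rw [norm_mul]
        gcongr
        · exact (f.restrict (Icc (-R) R)).norm_coe_le_norm ⟨u, abs_le.1 hu'.1⟩
        · simpa using hexp z hu'.2
      _ ≤ (‖f.restrict (Icc (-R) R)‖ * Real.exp (R * ‖z‖)) * R := by
        rw [sub_zero]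
        gcongr
      _ = ‖f.restrict (Icc (-R) R)‖ * R * Real.exp (R * ‖z‖) := by ring
      _ ≤ _ := by gcongr; exact le_max_right _ _

theorem conv_expConv (φ : C(ℝ, ℂ) →L[ℂ] ℂ) (f : C(ℝ, ℂ)) (z : ℂ) :
    conv φ (expConv f z) = φ (expConv f z) • expMonomial 0 z + expConv (conv φ f) z := by
  ext x
  let g : C(ℝ, ℂ) := ⟨fun y ↦ ∫ u in 0..x, f (y + u) * Complex.exp (z * (x - u)), by fun_prop⟩
  have hg : (expConv f z).translate x = Complex.exp (z * x) • expConv f z + g := by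
    ext y
    rw [translate_apply, add_comm, expConv_add, expConv_apply (f.translate y)]
    simp [g, add_comm]
  have hφg : φ g = expConv (conv φ f) z x := by
    rw [map_eq_intervalIntegral φ (g := g) (a := 0) (b := x)
      (H := fun u ↦ Complex.exp (z * (x - u)) • f.translate u) ?_ ?_]
    · simp [expConv_apply, mul_comm]
    · have : Continuous fun u ↦ f.translate u :=
        continuous_translate.comp (by fun_prop : Continuous fun u ↦ (f, u))
      fun_prop
    · intro y
      simp [g, mul_comm]
  rw [conv_apply, hg, map_add, hφg]
  simp [mul_comm]

theorem map_expConv_conv (φ ψ : C(ℝ, ℂ) →L[ℂ] ℂ) {f : C(ℝ, ℂ)} (hf : conv φ f = 0) (z : ℂ) :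
    φ (expConv (conv ψ f) z) =
      ψ (expMonomial 0 z) * φ (expConv f z) - φ (expMonomial 0 z) * ψ (expConv f z) := by
  have h := map_conv_comm φ ψ (expConv f z)
  have h0 : expConv 0 z = 0 := by
    ext y
    simp [expConv_apply]
  rw [conv_expConv, conv_expConv, hf, h0] at h
  simp only [map_add, map_smul, smul_eq_mul, map_zero] at h
  linear_combination h

theorem map_expConv_translate (φ : C(ℝ, ℂ) →L[ℂ] ℂ) {f : C(ℝ, ℂ)} (hf : conv φ f = 0) (t : ℝ)
    (z : ℂ) : φ (expConv (f.translate t) z) = Complex.exp (z * t) *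
      (φ (expConv f z) - φ (expMonomial 0 z) * ∫ u in 0..t, f u * Complex.exp (-z * u)) := by
  have hE : (expConv f z).translate t =
      expConv f z t • expMonomial 0 z + expConv (f.translate t) z := by
    ext y
    simp [expConv_add, mul_comm]
  have h0 : expConv 0 z = 0 := by
    ext y
    simp [expConv_apply]
  have h := congrArg (· t) (conv_expConv φ f z)
  simp only [conv_apply, hf, h0, hE, map_add, map_smul, smul_eq_mul, add_apply, smul_apply,
    expMonomial_apply, zero_apply, expConv_eq_mul f z t] at h
  linear_combination h

/-- A mean-periodic function without spectrum vanishes. -/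
theorem eq_zero_of_analyticOrderAt_le {φ : C(ℝ, ℂ) →L[ℂ] ℂ} {w : C(ℝ, ℂ)} (hw : conv φ w = 0)
    (hφ : ∃ c, φ (expMonomial 0 c) ≠ 0)
    (hord : ∀ z, analyticOrderAt (fun z ↦ φ (expMonomial 0 z)) z ≤
      analyticOrderAt (fun z ↦ φ (expConv w z)) z) : w = 0 := by
  have hM := differentiable_map_expMonomial φ 0
  obtain ⟨F, hF, hφF⟩ := exists_differentiable_mul_eq hM (differentiable_map_expConv φ w) hφ hord
  let W (t : ℝ) (z : ℂ) : ℂ :=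
    Complex.exp (z * t) * (F z - ∫ u in 0..t, w u * Complex.exp (-z * u))
  have hWd (t : ℝ) : Differentiable ℂ (W t) :=
    (by fun_prop : Differentiable ℂ fun z : ℂ ↦ Complex.exp (z * t)).mul
      (hF.sub (differentiable_truncatedLaplace w.continuous t))
  have hφW (t : ℝ) (z : ℂ) : φ (expConv (w.translate t) z) = φ (expMonomial 0 z) * W t z := by
    rw [map_expConv_translate φ hw, hφF]
    ring
  have hexp (a b : ℂ) (z : ℂ) : Complex.exp (z * (a + b)) =
      Complex.exp (z * a) * Complex.exp (z * b) := by
    rw [← Complex.exp_add, mul_add]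
  have hinv (a z : ℂ) : Complex.exp (z * a) * Complex.exp (-z * a) = 1 := by
    rw [← Complex.exp_add]
    simp
  have hWW (s t : ℝ) (z : ℂ) : W s z = (∫ u in 0..t, w.translate s u * Complex.exp (-z * u)) +
      Complex.exp (-z * t) * W (t + s) z := by
    have h := expConv_add w z t s
    simp only [expConv_eq_mul] at h
    simp only [W]
    push_cast at h ⊢
    rw [hexp] at h ⊢
    linear_combination Complex.exp (-z * t) * h + (-Complex.exp (z * s) * F z +
      Complex.exp (z * s) * (∫ u in 0..s, w u * Complex.exp (-z * u)) +
      ∫ u in 0..t, w.translate s u * Complex.exp (-z * u)) * hinv t z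
  obtain ⟨a, ha, hbound⟩ := exists_norm_map_le_exp φ
  have hW (t : ℝ) : ∃ C, ∀ z, ‖W t z‖ ≤ C * Real.exp (16 * a * ‖z‖) := by
    obtain ⟨C, hC⟩ := hbound (w.translate t)
    exact exists_norm_le_exp_of_mul_eq (differentiable_map_expConv φ _) hM (hWd t) (hφW t) hφ ha
      (fun z ↦ (hC z).2) fun z ↦ (hC z).1
  have hW0 (s : ℝ) (z : ℂ) : W s z = 0 :=
    eq_zero_of_forall_eq_truncatedLaplace_add (w.translate s).continuous (hWd s)
      (W := fun t ↦ W (t + s)) (fun t ↦ hW _) (hWW s) z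
  have hint (t : ℝ) : ∫ u in 0..t, w u = 0 := by
    have h0 := hW0 0 0
    have ht := hW0 t 0
    simp only [W] at h0 ht
    simp at h0 ht
    simpa [h0] using ht
  ext t
  have hd := intervalIntegral.integral_hasDerivAt_right (w.continuous.intervalIntegrable 0 t)
    (w.continuous.stronglyMeasurableAtFilter _ _) w.continuous.continuousAt
  simp_rw [hint] at hd
  exact hd.unique (hasDerivAt_const t 0)

theorem le_analyticOrderAt_map_expMonomial {φ : C(ℝ, ℂ) →L[ℂ] ℂ} {n : ℕ} {z : ℂ} :
    n ≤ analyticOrderAt (fun z ↦ φ (expMonomial 0 z)) z ↔ ∀ k < n, φ (expMonomial k z) = 0 := by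
  rw [natCast_le_analyticOrderAt_iff_iteratedDeriv_eq_zero
    ((differentiable_map_expMonomial φ 0).analyticAt z)]
  simp_rw [iteratedDeriv_map_expMonomial]

theorem analyticOrderAt_map_expConv_conv_ge {V : Submodule ℂ C(ℝ, ℂ)}
    (hV : ∀ g, (∀ φ : C(ℝ, ℂ) →L[ℂ] ℂ, (∀ h ∈ V, φ h = 0) → φ g = 0) → g ∈ V)
    (hinv : ∀ h ∈ V, ∀ x, h.translate x ∈ V) {ν : C(ℝ, ℂ) →L[ℂ] ℂ}
    (hν : ∀ k z, expMonomial k z ∈ V → ν (expMonomial k z) = 0) {f : C(ℝ, ℂ)} (hf : f ∈ V)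
    {φ : C(ℝ, ℂ) →L[ℂ] ℂ} (hφ : ∀ h ∈ V, φ h = 0) (z : ℂ) :
    analyticOrderAt (fun z ↦ φ (expMonomial 0 z)) z ≤
      analyticOrderAt (fun z ↦ φ (expConv (conv ν f) z)) z := by
  have hconv {φ : C(ℝ, ℂ) →L[ℂ] ℂ} (hφ : ∀ h ∈ V, φ h = 0) : conv φ f = 0 := by
    ext x
    exact hφ _ (hinv f hf x)
  have han (ψ : C(ℝ, ℂ) →L[ℂ] ℂ) : AnalyticAt ℂ (fun z ↦ ψ (expMonomial 0 z)) z :=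
    (differentiable_map_expMonomial ψ 0).analyticAt z
  have han' (ψ : C(ℝ, ℂ) →L[ℂ] ℂ) : AnalyticAt ℂ (fun z ↦ ψ (expConv f z)) z :=
    (differentiable_map_expConv ψ f).analyticAt z
  have heq : (fun z ↦ φ (expConv (conv ν f) z)) =
      (fun z ↦ ν (expMonomial 0 z)) * (fun z ↦ φ (expConv f z)) -
      (fun z ↦ φ (expMonomial 0 z)) * (fun z ↦ ν (expConv f z)) :=
    funext fun z ↦ map_expConv_conv φ ν (hconv hφ) z
  rw [heq]
  refine le_trans (le_min ?_ ?_) le_analyticOrderAt_sub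
  swap
  · rw [analyticOrderAt_mul (han _) (han' _)]
    exact le_self_add
  rw [analyticOrderAt_mul (han _) (han' _)]
  set p := analyticOrderAt (fun z ↦ φ (expConv f z)) z with hp
  by_cases hptop : p = ⊤
  · simp [hptop]
  have hmul (ψ : C(ℝ, ℂ) →L[ℂ] ℂ) (hψ : ∀ h ∈ V, ψ h = 0) :
      analyticOrderAt (fun z ↦ φ (expMonomial 0 z)) z ≤
        analyticOrderAt (fun z ↦ ψ (expMonomial 0 z)) z + p := by
    have h : (fun z ↦ ψ (expMonomial 0 z)) * (fun z ↦ φ (expConv f z)) =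
        (fun z ↦ φ (expMonomial 0 z)) * (fun z ↦ ψ (expConv f z)) := by
      funext z
      have h0 : expConv 0 z = 0 := by
        ext y
        simp [expConv_apply]
      have := map_expConv_conv φ ψ (hconv hφ) z
      rw [hconv hψ, h0, map_zero] at this
      exact (sub_eq_zero.1 this.symm)
    rw [hp, ← analyticOrderAt_mul (han _) (han' _), h, analyticOrderAt_mul (han _) (han' _)]
    exact le_self_add
  have hle (d : ℕ) (hd : d + p ≤ analyticOrderAt (fun z ↦ φ (expMonomial 0 z)) z) :
      d ≤ analyticOrderAt (fun z ↦ ν (expMonomial 0 z)) z := by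
    refine le_analyticOrderAt_map_expMonomial.2 fun k hk ↦ hν k z (hV _ fun ψ hψ ↦ ?_)
    exact le_analyticOrderAt_map_expMonomial.1
      ((ENat.add_le_add_iff_right hptop).1 (hd.trans (hmul ψ hψ))) k hk
  by_contra! hlt
  lift analyticOrderAt (fun z ↦ ν (expMonomial 0 z)) z to ℕ using
    (le_self_add.trans_lt hlt).ne_top with n
  lift p to ℕ using hptop with q
  have : (n + 1 : ℕ) ≤ (n : ℕ∞) := hle (n + 1) <| by
    have := Order.add_one_le_of_lt hlt
    push_cast
    rwa [add_right_comm]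
  norm_cast at this
  omega

end ContinuousMap

end

/-- Schwartz: every translation-invariant closed subspace of
`C(ℝ,ℂ)` (with the compact-open topology, i.e. uniform convergence on compact
sets) is the closed span of the exponential monomials `x ↦ xᵏ·exp(λx)` it
contains. -/
theorem schwartz_spectral_synthesis_on_real_line
    (V : Submodule ℂ C(ℝ, ℂ)) (hclosed : IsClosed (V : Set C(ℝ, ℂ)))
    (hinv : ∀ h ∈ V, ∀ g : ℝ, h.comp (Homeomorph.addRight g) ∈ V) :
    (V : Set C(ℝ, ℂ)) ⊆
      closure (Submodule.span ℂ
        {h : C(ℝ, ℂ) | h ∈ V ∧ ∃ (k : ℕ) (l : ℂ),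
          ∀ x : ℝ, h x = (x : ℂ) ^ k * Complex.exp (l * x)} : Set C(ℝ, ℂ)) := by
  intro f hf
  by_contra hcl
  obtain ⟨ν, hν, hνf⟩ := Submodule.exists_continuousLinearMap_of_notMem_closure hcl
  have hν' (k : ℕ) (z : ℂ) (h : ContinuousMap.expMonomial k z ∈ V) :
      ν (ContinuousMap.expMonomial k z) = 0 :=
    hν _ (Submodule.subset_span ⟨h, k, z, fun _ ↦ rfl⟩)
  have hV (g : C(ℝ, ℂ)) (hg : ∀ φ : C(ℝ, ℂ) →L[ℂ] ℂ, (∀ h ∈ V, φ h = 0) → φ g = 0) : g ∈ V := by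
    by_contra hgV
    rw [← SetLike.mem_coe, ← hclosed.closure_eq] at hgV
    obtain ⟨φ, hφ, hφg⟩ := Submodule.exists_continuousLinearMap_of_notMem_closure hgV
    exact hφg (hg φ hφ)
  by_cases hex : ∃ φ : C(ℝ, ℂ) →L[ℂ] ℂ, (∀ h ∈ V, φ h = 0) ∧
      ∃ c, φ (ContinuousMap.expMonomial 0 c) ≠ 0
  · obtain ⟨φ, hφ, hφ0⟩ := hex
    have hw : ContinuousMap.conv φ (ContinuousMap.conv ν f) = 0 := by
      ext x
      rw [ContinuousMap.conv_apply, ← ContinuousMap.conv_translate, ContinuousMap.map_conv_comm]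
      have : ContinuousMap.conv φ (f.translate x) = 0 := by
        ext y
        exact hφ _ (hinv _ (hinv f hf x) y)
      rw [this, map_zero, ContinuousMap.zero_apply]
    have := ContinuousMap.eq_zero_of_analyticOrderAt_le hw hφ0
      (ContinuousMap.analyticOrderAt_map_expConv_conv_ge hV hinv hν' hf hφ)
    refine hνf ?_
    have h0 := DFunLike.congr_fun this 0
    have ht : f.translate 0 = f := by
      ext y
      simp
    rwa [ContinuousMap.conv_apply, ht] at h0
  · push Not at hex
    exact hνf (by
      rw [ContinuousMap.eq_zero_of_map_expMonomial_eq_zero fun z ↦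
        hν' 0 z (hV _ fun φ hφ ↦ hex φ hφ z)]
      rfl)
end

section
/- (Lefranc) Let n be a positive integer and let V be a ℂ-linear subspace of the space of all functions ℤ^n → ℂ that is invariant under all translations f ↦ f(·+g) and closed in the topology of pointwise convergence (the product topology on ℂ^(ℤ^n)). Then the set of functions of the form x ↦ P(x₁,…,x_n)·λ₁^{x₁}⋯λ_n^{x_n}, with P a polynomial in n variables with complex coefficients and λ₁,…,λ_n nonzero complex numbers (integer powers taken in ℂˣ), that belong to V spans a ℂ-linear subspace that is dense in V. -/
open scoped BigOperators

/-- The integer powers of a unipotent unit of a `ℚ`-algebra depend polynomially on the exponent. -/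
theorem exists_polynomial_eval_eq_zpow {B : Type*} [CommRing B] [Algebra ℚ B] (w : Bˣ)
    (hw : IsNilpotent ((w : B) - 1)) :
    ∃ p : Polynomial B, ∀ x : ℤ, p.eval (x : B) = ((w ^ x : Bˣ) : B) := by
  obtain ⟨k, hk⟩ := hw
  have hk' : ((w : B) - 1) ^ (k + 1) = 0 := by rw [pow_succ, hk, zero_mul]
  have key (x : ℤ) :
      ∑ j ∈ Finset.range (k + 1), ((Ring.choose x j : ℤ) : B) * ((w : B) - 1) ^ j =
        ((w ^ x : Bˣ) : B) := by
    have step (x : ℤ) :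
        ∑ j ∈ Finset.range (k + 1), ((Ring.choose (x + 1) j : ℤ) : B) * ((w : B) - 1) ^ j =
          w * ∑ j ∈ Finset.range (k + 1), ((Ring.choose x j : ℤ) : B) * ((w : B) - 1) ^ j := by
      have h₁ : ∑ j ∈ Finset.range (k + 1), ((Ring.choose x j : ℤ) : B) * ((w : B) - 1) ^ (j + 1) =
          ∑ j ∈ Finset.range k, ((Ring.choose x j : ℤ) : B) * ((w : B) - 1) ^ (j + 1) := by
        rw [Finset.sum_range_succ, hk', mul_zero, add_zero]
      have h₂ : (w : B) * ∑ j ∈ Finset.range (k + 1),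
            ((Ring.choose x j : ℤ) : B) * ((w : B) - 1) ^ j =
          ∑ j ∈ Finset.range (k + 1), ((Ring.choose x j : ℤ) : B) * ((w : B) - 1) ^ (j + 1) +
            ∑ j ∈ Finset.range (k + 1), ((Ring.choose x j : ℤ) : B) * ((w : B) - 1) ^ j := by
        rw [Finset.mul_sum, ← Finset.sum_add_distrib]
        refine Finset.sum_congr rfl fun j _ => ?_
        ring
      rw [h₂, h₁, Finset.sum_range_succ', Finset.sum_range_succ' _ k, ← add_assoc,
        ← Finset.sum_add_distrib]
      congr 1
      · refine Finset.sum_congr rfl fun j _ => ?_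
        rw [Ring.choose_succ_succ]
        push_cast
        ring
      · simp
    induction x using Int.induction_on with
    | zero => simp [Finset.sum_range_succ', Ring.choose_zero_succ]
    | succ i ih => rw [step, ih, zpow_add_one, mul_comm, Units.val_mul]
    | pred i ih =>
      have h := step (-i - 1)
      rw [sub_add_cancel, ih] at h
      rw [zpow_sub_one, Units.val_mul, h, mul_comm, Units.inv_mul_cancel_left]
  refine ⟨∑ j ∈ Finset.range (k + 1), Polynomial.C
    (algebraMap ℚ B (j.factorial : ℚ)⁻¹ * ((w : B) - 1) ^ j) *
      (descPochhammer ℤ j).map (Int.castRingHom B), fun x => ?_⟩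
  rw [← key, Polynomial.eval_finsetSum]
  refine Finset.sum_congr rfl fun j _ => ?_
  have h : ((descPochhammer ℤ j).map (Int.castRingHom B)).eval (x : B) =
      algebraMap ℚ B j.factorial * ((Ring.choose x j : ℤ) : B) := by
    have := Ring.descPochhammer_eq_factorial_smul_choose x j
    rw [← Polynomial.eval_eq_smeval] at this
    rw [Polynomial.eval_intCast_map, Int.cast_id, this]
    simp
  have hj : algebraMap ℚ B (j.factorial : ℚ)⁻¹ * algebraMap ℚ B j.factorial = 1 := by
    rw [← map_mul, inv_mul_cancel₀ (by exact_mod_cast j.factorial_ne_zero), map_one]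
  rw [Polynomial.eval_mul, Polynomial.eval_C, h]
  linear_combination ((Ring.choose x j : ℤ) : B) * ((w : B) - 1) ^ j * hj

/-- A linear functional applied to the values of a polynomial with coefficients in an algebra
yields the values of a polynomial with scalar coefficients. -/
theorem MvPolynomial.exists_eval_intCast_eq_linearMap {σ K B : Type*} [Field K] [CommRing B]
    [Algebra K B] (φ : B →ₗ[K] K) (Q : MvPolynomial σ B) :
    ∃ P : MvPolynomial σ K, ∀ x : σ → ℤ,
      MvPolynomial.eval (fun i => (x i : K)) P = φ (MvPolynomial.eval (fun i => (x i : B)) Q) := by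
  induction Q using MvPolynomial.induction_on' with
  | monomial m b =>
    refine ⟨MvPolynomial.monomial m (φ b), fun x => ?_⟩
    have h : b * (m.prod fun i e => (x i : B) ^ e) =
        (m.prod fun i e => (x i : K) ^ e) • b := by
      rw [Algebra.smul_def, mul_comm]
      simp [Finsupp.prod]
    rw [MvPolynomial.eval_monomial, MvPolynomial.eval_monomial, h, map_smul, smul_eq_mul, mul_comm]
  | add p q hp hq =>
    obtain ⟨P, hP⟩ := hp
    obtain ⟨Q, hQ⟩ := hq
    exact ⟨P + Q, fun x => by simp [hP, hQ]⟩

/-- If each unit `u i` of a `ℂ`-algebra is a scalar `l i` plus a nilpotent, then the matrix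
coefficients of `x ↦ ∏ i, u i ^ x i` are exponential monomials. -/
theorem exists_eval_mul_prod_zpow_eq {σ B : Type*} [Fintype σ] [CommRing B] [Algebra ℂ B]
    (φ : B →ₗ[ℂ] ℂ) (u : σ → Bˣ) (l : σ → ℂˣ)
    (h : ∀ i, IsNilpotent ((u i : B) - algebraMap ℂ B (l i))) :
    ∃ P : MvPolynomial σ ℂ, ∀ x : σ → ℤ,
      φ (∏ i, ((u i ^ x i : Bˣ) : B)) =
        MvPolynomial.eval (fun i => (x i : ℂ)) P * ∏ i, ((l i ^ x i : ℂˣ) : ℂ) := by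
  let : Algebra ℚ B := ((algebraMap ℂ B).comp (algebraMap ℚ ℂ)).toAlgebra
  let s (i : σ) : Bˣ := Units.map (algebraMap ℂ B : ℂ →* B) (l i)
  have hs (i : σ) (x : ℤ) : ((s i ^ x : Bˣ) : B) = algebraMap ℂ B ((l i ^ x : ℂˣ) : ℂ) := by
    rw [← map_zpow]
    rfl
  have hnil (i : σ) : IsNilpotent (((s i)⁻¹ * u i : Bˣ) - 1 : B) := by
    have : (((s i)⁻¹ * u i : Bˣ) - 1 : B) =
        ((s i)⁻¹ : Bˣ) * ((u i : B) - algebraMap ℂ B (l i)) := by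
      rw [mul_sub, Units.val_mul]
      congr 1
      exact ((s i).inv_mul).symm
    rw [this]
    exact (Commute.all _ _).isNilpotent_mul_left (h i)
  choose p hp using fun i => exists_polynomial_eval_eq_zpow _ (hnil i)
  obtain ⟨P, hP⟩ := MvPolynomial.exists_eval_intCast_eq_linearMap φ
    (∏ i, Polynomial.aeval (MvPolynomial.X i : MvPolynomial σ B) (p i))
  refine ⟨P, fun x => ?_⟩
  have hQ : MvPolynomial.eval (fun i => (x i : B))
      (∏ i, Polynomial.aeval (MvPolynomial.X i : MvPolynomial σ B) (p i)) =
        ∏ i, ((((s i)⁻¹ * u i) ^ x i : Bˣ) : B) := by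
    rw [map_prod]
    refine Finset.prod_congr rfl fun i _ => ?_
    rw [← hp, ← MvPolynomial.coe_aeval_eq_eval, RingHom.coe_coe, ← Polynomial.aeval_algHom_apply]
    simp
  rw [hP, hQ, mul_comm, ← smul_eq_mul, ← map_smul, Algebra.smul_def,
    map_prod (algebraMap ℂ B), ← Finset.prod_mul_distrib]
  congr 1
  refine Finset.prod_congr rfl fun i _ => ?_
  rw [← hs, ← Units.val_mul, ← mul_zpow, mul_inv_cancel_left]

/-- In a Noetherian ring every ideal is the intersection of the ideals `I ⊔ m ^ k` with `m`
maximal. -/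
theorem Ideal.exists_isMaximal_notMem_sup_pow {A : Type*} [CommRing A] [IsNoetherianRing A]
    {I : Ideal A} {a : A} (ha : a ∉ I) :
    ∃ m : Ideal A, m.IsMaximal ∧ ∃ k : ℕ, a ∉ I ⊔ m ^ k := by
  have hne : I.colon {a} ≠ ⊤ := fun h => ha <| by
    have h1 : (1 : A) ∈ I.colon {a} := h ▸ Submodule.mem_top
    simpa [Submodule.mem_colon_singleton] using h1
  obtain ⟨m, hm, hle⟩ := Ideal.exists_le_maximal _ hne
  refine ⟨m, hm, ?_⟩
  by_contra! hall
  have hmem : (Submodule.Quotient.mk a : A ⧸ I) ∈ (⨅ k : ℕ, m ^ k • ⊤ : Submodule A (A ⧸ I)) := by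
    rw [Submodule.mem_iInf]
    intro k
    obtain ⟨b, hb, c, hc, rfl⟩ := Submodule.mem_sup.mp (hall k)
    have : (Submodule.Quotient.mk (b + c) : A ⧸ I) = c • Submodule.Quotient.mk 1 := by
      rw [← Submodule.Quotient.mk_smul, Submodule.Quotient.eq]
      simpa using hb
    rw [this]
    exact Submodule.smul_mem_smul hc Submodule.mem_top
  obtain ⟨⟨r, hr⟩, hra⟩ := (m.mem_iInf_smul_pow_eq_bot_iff _).mp hmem
  rw [← Submodule.Quotient.mk_smul, Submodule.Quotient.eq] at hra
  have hr1 : r - 1 ∈ m := hle <| by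
    rw [Submodule.mem_colon_singleton, smul_eq_mul, sub_mul, one_mul]
    exact hra
  exact hm.ne_top ((Ideal.eq_top_iff_one m).mpr (by simpa using m.sub_mem hr hr1))

/-- The weak Nullstellensatz: the residue fields of a finitely generated algebra over an
algebraically closed field are trivial extensions. -/
theorem Ideal.IsMaximal.exists_sub_algebraMap_mem {K A : Type*} [Field K] [IsAlgClosed K]
    [CommRing A] [Algebra K A] [Algebra.FiniteType K A] {m : Ideal A} (hm : m.IsMaximal) (a : A) :
    ∃ c : K, a - algebraMap K A c ∈ m := by
  let := Ideal.Quotient.field m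
  have := finite_of_finite_type_of_isJacobsonRing K (A ⧸ m)
  obtain ⟨c, hc⟩ := (IsAlgClosed.algebraMap_bijective_of_isIntegral (k := K) (K := A ⧸ m)).2
    (Ideal.Quotient.mk m a)
  exact ⟨c, Ideal.Quotient.eq.mp hc.symm⟩

/-- The pairing of a function on `G` with an element of the group algebra of `G`. -/
noncomputable def AddMonoidAlgebra.pairing {K G : Type*} [CommSemiring K] (f : G → K) :
    AddMonoidAlgebra K G →ₗ[K] K :=
  Finsupp.linearCombination K f ∘ₗ (AddMonoidAlgebra.coeffLinearEquiv K).toLinearMap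

@[simp]
theorem AddMonoidAlgebra.pairing_single {K G : Type*} [CommSemiring K] (f : G → K) (x : G)
    (c : K) : AddMonoidAlgebra.pairing f (.single x c) = c * f x := by
  simp [AddMonoidAlgebra.pairing]

theorem AddMonoidAlgebra.pairing_single_mul {K G : Type*} [CommSemiring K] [AddCommMonoid G]
    (f : G → K) (g : G) (c : K) (a : AddMonoidAlgebra K G) :
    AddMonoidAlgebra.pairing f (.single g c * a) =
      c * AddMonoidAlgebra.pairing (fun x => f (x + g)) a := by
  induction a using AddMonoidAlgebra.induction_linear with
  | zero => simp
  | add a₁ a₂ h₁ h₂ => rw [mul_add, map_add, map_add, h₁, h₂, mul_add]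
  | single x d =>
    rw [AddMonoidAlgebra.single_mul_single, AddMonoidAlgebra.pairing_single,
      AddMonoidAlgebra.pairing_single, add_comm g x, mul_assoc]

/-- The annihilator of a translation-invariant space of functions, as an ideal of the group
algebra. -/
noncomputable def AddMonoidAlgebra.annihilatorIdeal {K G : Type*} [CommRing K] [AddCommGroup G]
    (V : Submodule K (G → K)) (hinv : ∀ f ∈ V, ∀ g : G, (fun x => f (x + g)) ∈ V) :
    Ideal (AddMonoidAlgebra K G) where
  carrier := {a | ∀ f ∈ V, AddMonoidAlgebra.pairing f a = 0}
  zero_mem' := fun f _ => map_zero _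
  add_mem' := fun ha hb f hf => by rw [map_add, ha f hf, hb f hf, add_zero]
  smul_mem' := fun b a ha => by
    induction b using AddMonoidAlgebra.induction_linear with
    | zero => exact fun f _ => by rw [zero_smul, map_zero]
    | add b₁ b₂ h₁ h₂ => exact fun f hf => by rw [add_smul, map_add, h₁ f hf, h₂ f hf, add_zero]
    | single g c =>
      intro f hf
      rw [smul_eq_mul, AddMonoidAlgebra.pairing_single_mul, ha _ (hinv f hf g), mul_zero]

/-- A function outside the pointwise closure of a subspace is separated from it by an element of
the group algebra. -/
theorem AddMonoidAlgebra.exists_pairing_ne_zero_of_notMem_closure {K G : Type*} [Field K]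
    [TopologicalSpace K] {W : Submodule K (G → K)} {f : G → K}
    (hf : f ∉ closure (W : Set (G → K))) :
    ∃ a : AddMonoidAlgebra K G,
      AddMonoidAlgebra.pairing f a ≠ 0 ∧ ∀ w ∈ W, AddMonoidAlgebra.pairing w a = 0 := by
  classical
  obtain ⟨U, hU, hfU, hUW⟩ : ∃ U : Set (G → K), IsOpen U ∧ f ∈ U ∧ ∀ w ∈ W, w ∉ U := by
    refine ⟨_, isClosed_closure.isOpen_compl, hf, fun w hw h => h (subset_closure hw)⟩
  obtain ⟨S, t, hS, hSU⟩ := isOpen_pi_iff.mp hU f hfU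
  let ρ : (G → K) →ₗ[K] (S → K) := LinearMap.funLeft K K Subtype.val
  have hρ : ρ f ∉ W.map ρ := by
    rintro ⟨w, hw, hwf⟩
    refine hUW w hw (hSU fun x hx => ?_)
    have : w x = f x := congrFun hwf ⟨x, hx⟩
    exact this ▸ (hS x hx).2
  obtain ⟨ψ, hψf, hψ⟩ := Submodule.exists_le_ker_of_notMem hρ
  let a : AddMonoidAlgebra K G := ∑ s : S, .single (s : G) (ψ (Pi.single s 1))
  have ha (h : G → K) : AddMonoidAlgebra.pairing h a = ψ (ρ h) := by
    rw [map_sum, ψ.pi_apply_eq_sum_univ]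
    refine Finset.sum_congr rfl fun s _ => ?_
    rw [AddMonoidAlgebra.pairing_single, mul_comm, smul_eq_mul]
    congr 2
    ext j
    simp [Pi.single_apply, eq_comm]
  refine ⟨a, by rwa [ha], fun w hw => ?_⟩
  rw [ha]
  exact hψ (Submodule.mem_map_of_mem hw)

/-- Linear functionals on the group algebra of `ℤⁿ` that vanish on a power of a maximal ideal are
exponential monomials. -/
theorem AddMonoidAlgebra.exists_eval_mul_prod_zpow_eq {σ : Type*} [Fintype σ]
    {m : Ideal (AddMonoidAlgebra ℂ (σ → ℤ))} (hm : m.IsMaximal) (k : ℕ)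
    (φ : AddMonoidAlgebra ℂ (σ → ℤ) →ₗ[ℂ] ℂ) (hφ : ∀ a ∈ m ^ k, φ a = 0) :
    ∃ (P : MvPolynomial σ ℂ) (l : σ → ℂˣ), ∀ x : σ → ℤ,
      φ (.single x 1) =
        MvPolynomial.eval (fun i => (x i : ℂ)) P * ∏ i, ((l i ^ x i : ℂˣ) : ℂ) := by
  classical
  let χ : Multiplicative (σ → ℤ) →* (AddMonoidAlgebra ℂ (σ → ℤ) ⧸ m ^ k)ˣ :=
    ((Ideal.Quotient.mk (m ^ k) : _ →* _).comp (AddMonoidAlgebra.of ℂ (σ → ℤ))).toHomUnits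
  let e (i : σ) : Multiplicative (σ → ℤ) := .ofAdd (Pi.single i 1)
  have he (x : σ → ℤ) : Multiplicative.ofAdd x = ∏ i, e i ^ x i := by
    apply Multiplicative.toAdd.injective
    ext j
    simp [e, Finset.sum_apply, Pi.single_apply]
  choose c hc using fun i =>
    hm.exists_sub_algebraMap_mem (K := ℂ) (AddMonoidAlgebra.of ℂ (σ → ℤ) (e i))
  have hc0 (i : σ) : c i ≠ 0 := fun h0 => by
    have h := hc i
    rw [h0, map_zero, sub_zero] at h
    exact hm.ne_top (Ideal.eq_top_of_isUnit_mem _ h ((Group.isUnit (e i)).map _))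
  let φ' : (AddMonoidAlgebra ℂ (σ → ℤ) ⧸ m ^ k) →ₗ[ℂ] ℂ :=
    ((m ^ k).restrictScalars ℂ).liftQ φ hφ
  obtain ⟨P, hP⟩ := _root_.exists_eval_mul_prod_zpow_eq φ' (fun i => χ (e i))
    (fun i => Units.mk0 (c i) (hc0 i)) fun i => by
      refine ⟨k, ?_⟩
      exact Ideal.Quotient.eq_zero_iff_mem.mpr (Ideal.pow_mem_pow (hc i) k)
  refine ⟨P, fun i => Units.mk0 (c i) (hc0 i), fun x => ?_⟩
  rw [← hP, ← Units.coe_prod]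
  simp_rw [← map_zpow]
  rw [← map_prod, ← he]
  rfl



/-- Lefranc: spectral synthesis holds on `ℤⁿ`: every
translation-invariant subspace of `ℂ^(ℤⁿ)` closed under pointwise convergence
is the closed span of the exponential monomials
`x ↦ P(x₁,…,xₙ)·λ₁^{x₁}⋯λₙ^{xₙ}` it contains. -/
theorem lefranc_spectral_synthesis_on_Zn (n : ℕ) (hn : 0 < n)
    (V : Submodule ℂ ((Fin n → ℤ) → ℂ))
    (hclosed : IsClosed (V : Set ((Fin n → ℤ) → ℂ)))
    (hinv : ∀ f ∈ V, ∀ g : Fin n → ℤ, (fun x => f (x + g)) ∈ V) :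
    (V : Set ((Fin n → ℤ) → ℂ)) ⊆
      closure (Submodule.span ℂ
        {f : (Fin n → ℤ) → ℂ | f ∈ V ∧
          ∃ (P : MvPolynomial (Fin n) ℂ) (l : Fin n → ℂˣ),
            ∀ x : Fin n → ℤ,
              f x = (MvPolynomial.eval fun i => (x i : ℂ)) P *
                ∏ i, ((l i ^ x i : ℂˣ) : ℂ)} : Set ((Fin n → ℤ) → ℂ)) := by
  intro f hf
  by_contra hcl
  obtain ⟨a, haf, haW⟩ := AddMonoidAlgebra.exists_pairing_ne_zero_of_notMem_closure hcl
  have haI : a ∉ AddMonoidAlgebra.annihilatorIdeal V hinv := fun h => haf (h f hf)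
  have : IsNoetherianRing (AddMonoidAlgebra ℂ (Fin n → ℤ)) :=
    Algebra.FiniteType.isNoetherianRing ℂ _
  obtain ⟨m, hm, k, hmk⟩ := Ideal.exists_isMaximal_notMem_sup_pow haI
  obtain ⟨φ, hφa, hφ⟩ := Submodule.exists_le_ker_of_notMem
    (p := (AddMonoidAlgebra.annihilatorIdeal V hinv ⊔ m ^ k).restrictScalars ℂ) hmk
  have hpair : AddMonoidAlgebra.pairing (fun x => φ (.single x 1)) = φ := by
    ext x
    simp
  refine hφa ?_
  rw [← hpair]
  refine haW _ (Submodule.subset_span ⟨?_, AddMonoidAlgebra.exists_eval_mul_prod_zpow_eq hm k φ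
    fun b hb => hφ ((le_sup_right : m ^ k ≤ _) hb)⟩)
  by_contra hV
  rw [← SetLike.mem_coe, ← hclosed.closure_eq] at hV
  obtain ⟨b, hbφ, hbV⟩ := AddMonoidAlgebra.exists_pairing_ne_zero_of_notMem_closure hV
  rw [hpair] at hbφ
  exact hbφ (hφ ((le_sup_left : AddMonoidAlgebra.annihilatorIdeal V hinv ≤ _) hbV))
end
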